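/- Let γ > 0 and v(t) = (1/(2πγ)) ∫_{-2√γ}^{2√γ} e^{itλ} √(4γ - λ²) dλ. Then the self-convolution satisfies (v * v)(t) = -(i/(2πγ²)) ∫_{-2√γ}^{2√γ} e^{itμ} μ √(4γ - μ²) dμ for all real t, where (v*v)(t) = ∫_0^t v(s) v(t-s) ds. -/

import Mathlib

open Real Complex

/-- The Fourier transform of the rescaled semicircle density. -/
noncomputable def semicircleFourier (γ : ℝ) (t : ℝ) : ℂ :=
  (1 / (2 * π * γ) : ℂ) *
    ∫ lam in (-(2 * Real.sqrt γ))..(2 * Real.sqrt γ),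
      Complex.exp (Complex.I * t * lam) * (Real.sqrt (4 * γ - lam ^ 2) : ℂ)

open intervalIntegral

/-- Termwise integration of the exponential series against a continuous weight. -/
theorem hasSum_integral_exp_mul {f : ℝ → ℂ} (hf : Continuous f) (a b t : ℝ) :
    HasSum (fun n : ℕ => (Complex.I * t) ^ n / (n.factorial : ℂ) * ∫ x in a..b, (x : ℂ) ^ n * f x)
      (∫ x in a..b, Complex.exp (Complex.I * t * x) * f x) := by
  have key : HasSum (fun n : ℕ => ∫ x in a..b, (Complex.I * t * x) ^ n / (n.factorial : ℂ) * f x)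
      (∫ x in a..b, Complex.exp (Complex.I * t * x) * f x) := by
    have hs : ∀ x : ℝ, HasSum (fun n : ℕ => (|t| * |x|) ^ n / (n.factorial : ℝ) * ‖f x‖)
        (Real.exp (|t| * |x|) * ‖f x‖) := fun x => by
      rw [Real.exp_eq_exp_ℝ]
      exact (NormedSpace.expSeries_div_hasSum_exp (|t| * |x|)).mul_right _
    refine intervalIntegral.hasSum_integral_of_dominated_convergence
      (fun n x => (|t| * |x|) ^ n / (n.factorial : ℝ) * ‖f x‖) (fun n => ?_) (fun n => ?_) ?_ ?_ ?_
    · exact Continuous.aestronglyMeasurable (by fun_prop)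
    · refine Filter.Eventually.of_forall fun x _ => le_of_eq ?_
      simp
    · exact Filter.Eventually.of_forall fun x _ => (hs x).summable
    · simp_rw [fun x => (hs x).tsum_eq]
      exact Continuous.intervalIntegrable (by fun_prop) _ _
    · refine Filter.Eventually.of_forall fun x _ => ?_
      rw [Complex.exp_eq_exp_ℂ]
      exact (NormedSpace.expSeries_div_hasSum_exp (Complex.I * t * x)).mul_right _
  convert key using 2 with n
  rw [← intervalIntegral.integral_const_mul]
  congr 1 with x
  ring

/-- The Euler beta integral with natural exponents, scaled to `[0, t]`. -/
theorem integral_pow_mul_sub_pow (a b : ℕ) (t : ℝ) :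
    ∫ s in (0:ℝ)..t, s ^ a * (t - s) ^ b =
      a.factorial * b.factorial / (a + b + 1).factorial * t ^ (a + b + 1) := by
  induction b generalizing a with
  | zero =>
    simp [Nat.factorial_succ]
    field_simp
  | succ b ih =>
    have h : ∫ s in (0:ℝ)..t,
        ((a + 1) * (s ^ a * (t - s) ^ (b + 1)) - (b + 1) * (s ^ (a + 1) * (t - s) ^ b)) = 0 := by
      rw [integral_eq_sub_of_hasDerivAt (f := fun s => s ^ (a + 1) * (t - s) ^ (b + 1))]
      · simp
      · intro s _
        convert! (hasDerivAt_pow (a + 1) s).mul (((hasDerivAt_id s).const_sub t).pow (b + 1)) using 1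
        simp
        ring
      · exact Continuous.intervalIntegrable (by fun_prop) _ _
    rw [intervalIntegral.integral_sub (Continuous.intervalIntegrable (by fun_prop) _ _)
      (Continuous.intervalIntegrable (by fun_prop) _ _), intervalIntegral.integral_const_mul,
      intervalIntegral.integral_const_mul, ih] at h
    have e : a + 1 + b + 1 = a + (b + 1) + 1 := by ring
    rw [e, Nat.factorial_succ a] at h
    rw [Nat.factorial_succ b]
    have ha : (a + 1 : ℝ) ≠ 0 := by positivity
    apply mul_left_cancel₀ ha
    push_cast at h ⊢
    linear_combination h

/-- Recursion for the moments of the weight `√(r² - x²)`, from integrating the derivative of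
`x ^ n * (r² - x²) ^ (3 / 2)`. -/
theorem integral_deriv_pow_mul_sqrt {r : ℝ} (hr : 0 ≤ r) (n : ℕ) :
    ∫ x in -r..r, (n * x ^ (n - 1) * (r ^ 2 - x ^ 2) - 3 * x ^ (n + 1)) * √(r ^ 2 - x ^ 2) = 0 := by
  rw [integral_eq_sub_of_hasDerivAt_of_le
    (f := fun x => x ^ n * ((r ^ 2 - x ^ 2) * √(r ^ 2 - x ^ 2))) (by linarith)]
  · simp
  · fun_prop
  · intro x hx
    have hpos : 0 < r ^ 2 - x ^ 2 := by nlinarith [hx.1, hx.2]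
    have hq : HasDerivAt (fun x : ℝ => r ^ 2 - x ^ 2) (-(2 * x)) x := by
      simpa using (hasDerivAt_pow 2 x).const_sub (r ^ 2)
    convert! (hasDerivAt_pow n x).mul (hq.mul (hq.sqrt hpos.ne')) using 1
    have hs : √(r ^ 2 - x ^ 2) ≠ 0 := (Real.sqrt_pos.2 hpos).ne'
    have hss : √(r ^ 2 - x ^ 2) ^ 2 = r ^ 2 - x ^ 2 := Real.sq_sqrt hpos.le
    simp only [Pi.mul_apply]
    field_simp
    rw [hss]
    ring
  · exact Continuous.intervalIntegrable (by fun_prop) _ _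

theorem integral_pow_mul_sqrt_recursion {r : ℝ} (hr : 0 ≤ r) (n : ℕ) :
    (n + 4) * ∫ x in -r..r, x ^ (n + 2) * √(r ^ 2 - x ^ 2) =
      r ^ 2 * (n + 1) * ∫ x in -r..r, x ^ n * √(r ^ 2 - x ^ 2) := by
  have h := integral_deriv_pow_mul_sqrt hr (n + 1)
  have e : ∀ x : ℝ, (((n + 1 : ℕ) : ℝ) * x ^ (n + 1 - 1) * (r ^ 2 - x ^ 2) - 3 * x ^ (n + 1 + 1)) *
      √(r ^ 2 - x ^ 2) = r ^ 2 * (n + 1) * (x ^ n * √(r ^ 2 - x ^ 2)) -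
        (n + 4) * (x ^ (n + 2) * √(r ^ 2 - x ^ 2)) := fun x => by
    push_cast
    ring
  simp_rw [e] at h
  rw [intervalIntegral.integral_sub (Continuous.intervalIntegrable (by fun_prop) _ _)
    (Continuous.intervalIntegrable (by fun_prop) _ _), intervalIntegral.integral_const_mul,
    intervalIntegral.integral_const_mul] at h
  linarith

theorem integral_odd_pow_mul_sqrt {r : ℝ} (hr : 0 ≤ r) (k : ℕ) :
    ∫ x in -r..r, x ^ (2 * k + 1) * √(r ^ 2 - x ^ 2) = 0 := by
  induction k with
  | zero =>
    have h := integral_deriv_pow_mul_sqrt hr 0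
    simp only [Nat.cast_zero, zero_mul, zero_sub, ← neg_mul, mul_assoc] at h
    rw [intervalIntegral.integral_const_mul] at h
    simpa using h
  | succ k ih =>
    have h := integral_pow_mul_sqrt_recursion hr (2 * k + 1)
    rw [ih, mul_zero] at h
    exact (mul_eq_zero.1 h).resolve_left (by positivity)

theorem succ_succ_mul_catalan_succ (k : ℕ) :
    (k + 2) * catalan (k + 1) = 2 * (2 * k + 1) * catalan k := by
  have h := Nat.succ_mul_centralBinom_succ k
  rw [← succ_mul_catalan_eq_centralBinom, ← succ_mul_catalan_eq_centralBinom] at h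
  apply Nat.eq_of_mul_eq_mul_left k.succ_pos
  linarith

theorem integral_sqrt_sq_sub_sq {r : ℝ} (hr : 0 ≤ r) :
    ∫ x in -r..r, √(r ^ 2 - x ^ 2) = π * r ^ 2 / 2 := by
  have h := intervalIntegral.mul_integral_comp_mul_left (a := -1) (b := 1)
    (f := fun x => √(r ^ 2 - x ^ 2)) r
  have e : ∀ x : ℝ, √(r ^ 2 - (r * x) ^ 2) = r * √(1 - x ^ 2) := fun x => by
    rw [show r ^ 2 - (r * x) ^ 2 = r ^ 2 * (1 - x ^ 2) by ring, Real.sqrt_mul (sq_nonneg r),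
      Real.sqrt_sq hr]
  simp_rw [e] at h
  rw [intervalIntegral.integral_const_mul, integral_sqrt_one_sub_sq] at h
  simp only [mul_neg, mul_one] at h
  rw [← h]
  ring

/-- The even moments of the semicircle weight are Catalan numbers. -/
theorem integral_even_pow_mul_sqrt {γ : ℝ} (hγ : 0 < γ) (k : ℕ) :
    ∫ x in -(2 * √γ)..(2 * √γ), x ^ (2 * k) * √(4 * γ - x ^ 2) =
      2 * π * γ * (γ ^ k * catalan k) := by
  have hr : (2 * √γ) ^ 2 = 4 * γ := by rw [mul_pow, Real.sq_sqrt hγ.le]; norm_num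
  induction k with
  | zero =>
    have h := integral_sqrt_sq_sub_sq (r := 2 * √γ) (by positivity)
    rw [hr] at h
    simp [h]
    ring
  | succ k ih =>
    have h := integral_pow_mul_sqrt_recursion (r := 2 * √γ) (by positivity) (2 * k)
    rw [hr, ih] at h
    have hc : ((k : ℝ) + 2) * catalan (k + 1) = 2 * (2 * k + 1) * catalan k := by
      exact_mod_cast succ_succ_mul_catalan_succ k
    have hk : (2 * (k : ℝ) + 4) ≠ 0 := by positivity
    apply mul_left_cancel₀ hk
    push_cast at h
    rw [show 2 * (k + 1) = 2 * k + 2 by ring, h]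
    linear_combination (-(4 * π * γ * γ ^ (k + 1))) * hc

theorem integral_odd_pow_mul_sqrt_four_mul {γ : ℝ} (hγ : 0 < γ) (k : ℕ) :
    ∫ x in -(2 * √γ)..(2 * √γ), x ^ (2 * k + 1) * √(4 * γ - x ^ 2) = 0 := by
  have h := integral_odd_pow_mul_sqrt (r := 2 * √γ) (by positivity) k
  rwa [show (2 * √γ) ^ 2 = 4 * γ by rw [mul_pow, Real.sq_sqrt hγ.le]; norm_num] at h

theorem integral_ofReal_pow_mul_sqrt (γ a b : ℝ) (n : ℕ) :
    ∫ x in a..b, (x : ℂ) ^ n * (√(4 * γ - x ^ 2) : ℂ) =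
      ((∫ x in a..b, x ^ n * √(4 * γ - x ^ 2) : ℝ) : ℂ) := by
  rw [← intervalIntegral.integral_ofReal]
  push_cast
  rfl

theorem hasSum_semicircleFourier {γ : ℝ} (hγ : 0 < γ) (t : ℝ) :
    HasSum (fun k : ℕ => (catalan k : ℂ) * (-γ) ^ k * t ^ (2 * k) / ((2 * k).factorial : ℂ))
      (semicircleFourier γ t) := by
  have h := (hasSum_integral_exp_mul (f := fun x => (√(4 * γ - x ^ 2) : ℂ)) (by fun_prop)
    (-(2 * √γ)) (2 * √γ) t).mul_left (1 / (2 * π * γ) : ℂ)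
  simp_rw [integral_ofReal_pow_mul_sqrt] at h
  rw [← (mul_right_injective₀ (two_ne_zero' ℕ)).hasSum_iff] at h
  · convert! h using 2 with k
    simp only [Function.comp, integral_even_pow_mul_sqrt hγ]
    have hγ' : (γ : ℂ) ≠ 0 := by exact_mod_cast hγ.ne'
    have hπ : (π : ℂ) ≠ 0 := by exact_mod_cast Real.pi_ne_zero
    push_cast
    rw [mul_pow, pow_mul Complex.I, Complex.I_sq, neg_pow (γ : ℂ)]
    field_simp
  · intro n hn
    obtain ⟨k, rfl⟩ : Odd n := by
      rw [← Nat.not_even_iff_odd]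
      exact fun ⟨k, hk⟩ => hn ⟨k, by simp [hk, two_mul]⟩
    rw [integral_odd_pow_mul_sqrt_four_mul hγ]
    simp

theorem hasSum_semicircleFourier_first_moment {γ : ℝ} (hγ : 0 < γ) (t : ℝ) :
    HasSum (fun k : ℕ =>
        (catalan (k + 1) : ℂ) * (-γ) ^ k * t ^ (2 * k + 1) / ((2 * k + 1).factorial : ℂ))
      (-(Complex.I / (2 * π * γ ^ 2)) * ∫ x in -(2 * √γ)..(2 * √γ),
        Complex.exp (Complex.I * t * x) * x * (√(4 * γ - x ^ 2) : ℂ)) := by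
  have h := (hasSum_integral_exp_mul (f := fun x => x * (√(4 * γ - x ^ 2) : ℂ)) (by fun_prop)
    (-(2 * √γ)) (2 * √γ) t).mul_left (-(Complex.I / (2 * π * γ ^ 2)))
  simp_rw [← mul_assoc _ (_ : ℂ) (√_ : ℂ), ← pow_succ, integral_ofReal_pow_mul_sqrt] at h
  have hinj : Function.Injective fun k : ℕ => 2 * k + 1 := fun a b hab => by simpa using hab
  rw [← hinj.hasSum_iff] at h
  · convert! h using 2 with k
    simp only [Function.comp, show 2 * k + 1 + 1 = 2 * (k + 1) by ring,
      integral_even_pow_mul_sqrt hγ]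
    have hγ' : (γ : ℂ) ≠ 0 := by exact_mod_cast hγ.ne'
    have hπ : (π : ℂ) ≠ 0 := by exact_mod_cast Real.pi_ne_zero
    push_cast
    rw [mul_pow, pow_succ Complex.I, pow_mul Complex.I, Complex.I_sq, neg_pow (γ : ℂ)]
    field_simp
    rw [Complex.I_sq]
    ring
  · intro n hn
    obtain ⟨k, rfl⟩ : Even n := by
      rw [← Nat.not_odd_iff_even]
      exact fun ⟨k, hk⟩ => hn ⟨k, hk.symm⟩
    rw [← two_mul, integral_odd_pow_mul_sqrt_four_mul hγ]
    simp

theorem integral_ofReal_pow_mul_sub_pow_div_factorial (a b : ℕ) (t : ℝ) :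
    ∫ s in (0:ℝ)..t,
      (s : ℂ) ^ a / (a.factorial : ℂ) * (((t - s : ℝ) : ℂ) ^ b / (b.factorial : ℂ)) =
      (t : ℂ) ^ (a + b + 1) / ((a + b + 1).factorial : ℂ) := by
  have ha : (a.factorial : ℝ) ≠ 0 := by positivity
  have hb : (b.factorial : ℝ) ≠ 0 := by positivity
  have h : ∫ s in (0:ℝ)..t, s ^ a / (a.factorial : ℝ) * ((t - s) ^ b / (b.factorial : ℝ)) =
      t ^ (a + b + 1) / ((a + b + 1).factorial : ℝ) := by
    simp_rw [div_mul_div_comm]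
    rw [intervalIntegral.integral_div, integral_pow_mul_sub_pow]
    field_simp
  rw [show (t : ℂ) ^ (a + b + 1) / ((a + b + 1).factorial : ℂ) =
    ((t ^ (a + b + 1) / ((a + b + 1).factorial : ℝ) : ℝ) : ℂ) by push_cast; rfl, ← h,
    ← intervalIntegral.integral_ofReal]
  push_cast
  rfl

theorem hasSum_integral_semicircleFourier_mul {γ : ℝ} (hγ : 0 < γ) (t : ℝ) :
    HasSum (fun p : ℕ × ℕ => (catalan p.1 : ℂ) * (-γ) ^ p.1 * (catalan p.2 * (-γ) ^ p.2) *
        (t ^ (2 * p.1 + 2 * p.2 + 1) / ((2 * p.1 + 2 * p.2 + 1).factorial : ℂ)))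
      (∫ s in (0:ℝ)..t, semicircleFourier γ s * semicircleFourier γ (t - s)) := by
  let u : ℝ → ℕ → ℂ := fun s k =>
    (catalan k : ℂ) * (-γ) ^ k * s ^ (2 * k) / ((2 * k).factorial : ℂ)
  have hu : ∀ s, HasSum (u s) (semicircleFourier γ s) := hasSum_semicircleFourier hγ
  have hcont : ∀ k, Continuous fun s => u s k := fun k => by fun_prop
  have hnorm : ∀ s, Summable fun k => ‖u s k‖ := fun s => (hu s).summable.norm
  have hmono : ∀ s, |s| ≤ |t| → ∀ k, ‖u s k‖ ≤ ‖u t k‖ := fun s hs k => by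
    simp only [u, norm_div, norm_mul, norm_pow, Complex.norm_real, Real.norm_eq_abs]
    gcongr
  have key : HasSum (fun p : ℕ × ℕ => ∫ s in (0:ℝ)..t, u s p.1 * u (t - s) p.2)
      (∫ s in (0:ℝ)..t, semicircleFourier γ s * semicircleFourier γ (t - s)) := by
    refine intervalIntegral.hasSum_integral_of_dominated_convergence
      (fun p _ => ‖u t p.1‖ * ‖u t p.2‖) (fun p => ?_) (fun p => ?_) ?_ ?_ ?_
    · exact ((hcont p.1).mul ((hcont p.2).comp (by fun_prop))).aestronglyMeasurable
    · refine Filter.Eventually.of_forall fun s hs => ?_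
      have hs' : s ∈ Set.uIcc 0 t := Set.uIoc_subset_uIcc hs
      rw [norm_mul]
      gcongr
      · exact hmono s (by simpa using Set.abs_sub_left_of_mem_uIcc hs') _
      · exact hmono (t - s) (by simpa using Set.abs_sub_right_of_mem_uIcc hs') _
    · exact Filter.Eventually.of_forall fun s _ =>
        (hnorm t).mul_of_nonneg (hnorm t) (fun _ => norm_nonneg _) (fun _ => norm_nonneg _)
    · exact intervalIntegrable_const
    · exact Filter.Eventually.of_forall fun s _ =>
        (hu s).mul (hu (t - s)) (summable_mul_of_summable_norm (hnorm s) (hnorm (t - s)))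
  convert! key using 2 with p
  rw [← integral_ofReal_pow_mul_sub_pow_div_factorial, ← intervalIntegral.integral_const_mul]
  congr 1 with s
  simp only [u]
  ring

theorem semicircle_fourier_self_convolution (γ : ℝ) (hγ : 0 < γ) (t : ℝ) :
    (∫ s in (0:ℝ)..t, semicircleFourier γ s * semicircleFourier γ (t - s)) =
      -(Complex.I / (2 * π * γ ^ 2)) *
        ∫ μ in (-(2 * Real.sqrt γ))..(2 * Real.sqrt γ),
          Complex.exp (Complex.I * t * μ) * μ * (Real.sqrt (4 * γ - μ ^ 2) : ℂ) := by
  have h := ((Equiv.hasSum_iff Finset.HasAntidiagonal.sigmaAntidiagonalEquivProd).2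
    (hasSum_integral_semicircleFourier_mul hγ t)).sigma fun n => hasSum_fintype _
  refine h.unique ?_
  convert! hasSum_semicircleFourier_first_moment hγ t using 2 with n
  rw [catalan_succ', Nat.cast_sum, Finset.sum_mul, Finset.sum_mul, Finset.sum_div,
    ← Finset.sum_coe_sort (Finset.HasAntidiagonal.antidiagonal n)]
  refine Finset.sum_congr rfl fun p _ => ?_
  obtain ⟨⟨a, b⟩, hp⟩ := p
  obtain rfl : a + b = n := by simpa using hp
  simp only [Function.comp, Finset.HasAntidiagonal.sigmaAntidiagonalEquivProd_apply, ← mul_add]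
  push_cast
  ring
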